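/- Let T > 0 and let g be a Preisach density with Lipschitz bound μ ∈ L¹(0,∞) and M = ∫₀^∞ μ(r) dr. Let q : [0,T] → ℝ be absolutely continuous with max_{t∈[0,T]} |q(t)| < R, and for each r > 0 let ξ_r be the solution of the play variational inequality with threshold r and input q. Let δ > 0 and let 0 = r₀ < r₁ < … < r_m = R be a partition with r_j − r_{j−1} < δ for all j, and define g_j(v) := ∫_{r_{j−1}}^{r_j} g(r,v) dr for v ∈ ℝ, j = 1,…,m. Then for every t ∈ [0,T] one has |∫₀^∞ g(r, ξ_r(t)) dr − Σ_{j=1}^{m} g_j(ξ_{r_j}(t))| ≤ δ·∫₀^R μ(r) dr ≤ M δ. -/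

import Mathlib

open MeasureTheory Set

/-- `q` is absolutely continuous on `[0,T]` with a.e. derivative `q'`,
encoded via the fundamental theorem of calculus. -/
def IsACOn (T : ℝ) (q q' : ℝ → ℝ) : Prop :=
  IntegrableOn q' (Icc 0 T) ∧ ∀ t ∈ Icc 0 T, q t = q 0 + ∫ τ in (0:ℝ)..t, q' τ

/-- `ξ` (with a.e. derivative `ξ'`) solves the play variational inequality
with threshold `r` and input `q` on `[0,T]`:
(i) `|q - ξ| ≤ r` on `[0,T]`, (ii) `ξ'(t)(q(t) - ξ(t) - r z) ≥ 0` for a.e. `t`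
and all `z ∈ [-1,1]`, (iii) `ξ(0) = max{q(0) - r, min{0, q(0) + r}}`. -/
def IsPlaySol (T r : ℝ) (q ξ ξ' : ℝ → ℝ) : Prop :=
  IsACOn T ξ ξ' ∧
  (∀ t ∈ Icc 0 T, |q t - ξ t| ≤ r) ∧
  (∀ᵐ t ∂(volume.restrict (Ioo 0 T)),
    ∀ z ∈ Icc (-1:ℝ) 1, ξ' t * (q t - ξ t - r * z) ≥ 0) ∧
  ξ 0 = max (q 0 - r) (min 0 (q 0 + r))

/-- `g : (0,∞) × ℝ → ℝ` is a Preisach density with Lipschitz bound `μ`: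
`g` is measurable, `μ ∈ L¹(0,∞)`, and for a.e. `r > 0` one has `g(r,0) = 0`
and `v ↦ g(r,v)` is nondecreasing and Lipschitz with constant `μ(r) ≥ 0`. -/
def IsPreisachDensity (g : ℝ → ℝ → ℝ) (μ : ℝ → ℝ) : Prop :=
  Measurable (Function.uncurry g) ∧
  IntegrableOn μ (Ioi 0) ∧
  ∀ᵐ r ∂(volume.restrict (Ioi (0:ℝ))),
    g r 0 = 0 ∧ 0 ≤ μ r ∧ Monotone (g r) ∧
      LipschitzWith (Real.toNNReal (μ r)) (g r)

theorem IsACOn.continuousOn {T : ℝ} {w w' : ℝ → ℝ} (hT : 0 ≤ T) (hw : IsACOn T w w') :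
    ContinuousOn w (Icc 0 T) := by
  have h := intervalIntegral.continuousOn_primitive_interval (a := 0) (b := T) (μ := volume)
    (f := w') (by rw [uIcc_of_le hT]; exact hw.1)
  rw [uIcc_of_le hT] at h
  exact (continuousOn_const.add h).congr hw.2

theorem IsACOn.sub_eq_integral {T : ℝ} {w w' : ℝ → ℝ} (hw : IsACOn T w w') {s t : ℝ}
    (hs : s ∈ Icc 0 T) (ht : t ∈ Icc 0 T) : w t - w s = ∫ τ in s..t, w' τ := by
  have h0 : ∀ x ∈ Icc 0 T, IntervalIntegrable w' volume 0 x := fun x hx ↦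
    (intervalIntegrable_iff_integrableOn_Icc_of_le hx.1).2
      (hw.1.mono_set (Icc_subset_Icc_right hx.2))
  rw [hw.2 t ht, hw.2 s hs, ← intervalIntegral.integral_interval_sub_left (h0 t ht) (h0 s hs)]
  ring

theorem IsACOn.sub {T : ℝ} {w w' v v' : ℝ → ℝ} (hw : IsACOn T w w') (hv : IsACOn T v v') :
    IsACOn T (fun t ↦ w t - v t) (fun t ↦ w' t - v' t) := by
  refine ⟨hw.1.sub hv.1, fun t ht ↦ ?_⟩
  have h0 : (0 : ℝ) ∈ Icc 0 T := ⟨le_rfl, ht.1.trans ht.2⟩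
  have hi : ∀ {f : ℝ → ℝ}, IntegrableOn f (Icc 0 T) → IntervalIntegrable f volume 0 t := fun hf ↦
    (intervalIntegrable_iff_integrableOn_Icc_of_le ht.1).2
      (hf.mono_set (Icc_subset_Icc_right ht.2))
  rw [intervalIntegral.integral_sub (hi hw.1) (hi hv.1), ← hw.sub_eq_integral h0 ht,
    ← hv.sub_eq_integral h0 ht]
  ring

theorem IsACOn.neg {T : ℝ} {w w' : ℝ → ℝ} (hw : IsACOn T w w') :
    IsACOn T (fun t ↦ -w t) (fun t ↦ -w' t) := by
  refine ⟨hw.1.neg, fun t ht ↦ ?_⟩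
  have h := hw.2 t ht
  rw [intervalIntegral.integral_neg]
  linarith

/-- An absolutely continuous function that starts below `c` and whose derivative is nonpositive
wherever it exceeds `c` stays below `c`. -/
theorem IsACOn.le_of_deriv_nonpos_of_lt {T c : ℝ} {w w' : ℝ → ℝ} (hw : IsACOn T w w')
    (h0 : w 0 ≤ c) (h : ∀ᵐ t ∂(volume.restrict (Ioo 0 T)), c < w t → w' t ≤ 0) :
    ∀ t ∈ Icc 0 T, w t ≤ c := by
  intro t ht
  by_contra! hlt
  have hcont : ContinuousOn w (Icc 0 t) :=
    (hw.continuousOn (ht.1.trans ht.2)).mono (Icc_subset_Icc_right ht.2)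
  have hcomp : IsCompact (Icc 0 t ∩ w ⁻¹' Iic c) :=
    isCompact_Icc.of_isClosed_subset (hcont.preimage_isClosed_of_isClosed isClosed_Icc isClosed_Iic)
      inter_subset_left
  obtain ⟨s, ⟨hs, hsc⟩, hmax⟩ := hcomp.exists_isGreatest ⟨0, ⟨le_rfl, ht.1⟩, h0⟩
  have habove : ∀ τ ∈ Ioc s t, c < w τ := by
    intro τ hτ
    by_contra! hle
    exact (hmax ⟨⟨hs.1.trans hτ.1.le, hτ.2⟩, hle⟩).not_gt hτ.1
  have hsub : Ioo s t ⊆ Ioo 0 T := Ioo_subset_Ioo hs.1 ht.2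
  have hint : ∫ τ in s..t, w' τ ≤ 0 := by
    rw [intervalIntegral.integral_of_le hs.2, integral_Ioc_eq_integral_Ioo]
    refine integral_nonpos_of_ae ?_
    filter_upwards [ae_restrict_of_ae_restrict_of_subset hsub h,
      ae_restrict_mem measurableSet_Ioo] with τ hτ hmem
    exact hτ (habove τ ⟨hmem.1, hmem.2.le⟩)
  have hdiff := hw.sub_eq_integral ⟨hs.1, hs.2.trans ht.2⟩ ht
  have hsc' : w s ≤ c := hsc
  linarith

theorem IsPlaySol.deriv_sign {T r : ℝ} {q ξ ξ' : ℝ → ℝ} (h : IsPlaySol T r q ξ ξ') :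
    ∀ᵐ t ∂(volume.restrict (Ioo 0 T)),
      (q t - ξ t < r → ξ' t ≤ 0) ∧ (-r < q t - ξ t → 0 ≤ ξ' t) := by
  filter_upwards [h.2.2.1] with t ht
  have h1 := ht 1 (by norm_num)
  have h2 := ht (-1) (by norm_num)
  refine ⟨fun hlt ↦ ?_, fun hlt ↦ ?_⟩
  · by_contra! hpos
    nlinarith
  · by_contra! hneg
    nlinarith

/-- The play operator is nonexpansive with respect to its threshold. -/
theorem IsPlaySol.abs_sub_le {T r s : ℝ} {q ξ ξ' η η' : ℝ → ℝ} (hrs : r ≤ s) (hr : 0 ≤ r)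
    (h : IsPlaySol T r q ξ ξ') (k : IsPlaySol T s q η η') :
    ∀ t ∈ Icc 0 T, |ξ t - η t| ≤ s - r := by
  intro t ht
  have hξ0 := h.2.2.2
  have hη0 := k.2.2.2
  have hinit : ξ 0 - η 0 ≤ s - r ∧ η 0 - ξ 0 ≤ s - r := by
    rw [hξ0, hη0]
    constructor <;> simp only [max_def, min_def] <;> split_ifs <;> linarith
  refine abs_sub_le_iff.2 ⟨?_, ?_⟩
  · refine (h.1.sub k.1).le_of_deriv_nonpos_of_lt hinit.1 ?_ t ht
    filter_upwards [h.deriv_sign, k.deriv_sign, ae_restrict_mem measurableSet_Ioo]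
      with τ h1 h2 hτ hlt
    have h3 := abs_le.1 (h.2.1 τ (Ioo_subset_Icc_self hτ))
    have h4 := abs_le.1 (k.2.1 τ (Ioo_subset_Icc_self hτ))
    have h5 := h1.1 (by linarith)
    have h6 := h2.2 (by linarith)
    linarith
  · refine (k.1.sub h.1).le_of_deriv_nonpos_of_lt hinit.2 ?_ t ht
    filter_upwards [h.deriv_sign, k.deriv_sign, ae_restrict_mem measurableSet_Ioo]
      with τ h1 h2 hτ hlt
    have h3 := abs_le.1 (h.2.1 τ (Ioo_subset_Icc_self hτ))
    have h4 := abs_le.1 (k.2.1 τ (Ioo_subset_Icc_self hτ))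
    have h5 := h1.2 (by linarith)
    have h6 := h2.1 (by linarith)
    linarith

/-- The play operator vanishes when its threshold dominates the input. -/
theorem IsPlaySol.eq_zero {T r : ℝ} {q ξ ξ' : ℝ → ℝ} (h : IsPlaySol T r q ξ ξ')
    (hq : ∀ t ∈ Icc 0 T, |q t| < r) : ∀ t ∈ Icc 0 T, ξ t = 0 := by
  intro t ht
  have h0 : ξ 0 = 0 := by
    have hq0 := abs_lt.1 (hq 0 ⟨le_rfl, ht.1.trans ht.2⟩)
    rw [h.2.2.2, min_eq_left (by linarith), max_eq_right (by linarith)]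
  refine le_antisymm ?_ (neg_nonpos.1 ?_)
  · refine h.1.le_of_deriv_nonpos_of_lt h0.le ?_ t ht
    filter_upwards [h.deriv_sign, ae_restrict_mem measurableSet_Ioo] with τ h1 hτ hlt
    have hqτ := abs_lt.1 (hq τ (Ioo_subset_Icc_self hτ))
    exact h1.1 (by linarith)
  · refine h.1.neg.le_of_deriv_nonpos_of_lt (by simp [h0]) ?_ t ht
    filter_upwards [h.deriv_sign, ae_restrict_mem measurableSet_Ioo] with τ h1 hτ hlt
    have hqτ := abs_lt.1 (hq τ (Ioo_subset_Icc_self hτ))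
    exact neg_nonpos.2 (h1.2 (by linarith))

theorem IsPreisachDensity.ae_abs_sub_le {g : ℝ → ℝ → ℝ} {μ : ℝ → ℝ}
    (hg : IsPreisachDensity g μ) :
    ∀ᵐ ρ ∂(volume.restrict (Ioi (0 : ℝ))), ∀ u v, |g ρ u - g ρ v| ≤ μ ρ * |u - v| := by
  filter_upwards [hg.2.2] with ρ hρ u v
  have h := hρ.2.2.2.dist_le_mul u v
  rwa [Real.coe_toNNReal _ hρ.2.1, Real.dist_eq, Real.dist_eq] at h

/-- Superposition with a bounded, measurable selection of arguments is integrable. -/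
theorem IsPreisachDensity.integrableOn_comp {g : ℝ → ℝ → ℝ} {μ u : ℝ → ℝ} {C : ℝ} {s : Set ℝ}
    (hg : IsPreisachDensity g μ) (hs : s ⊆ Ioi 0) (hsm : MeasurableSet s)
    (hu : AEMeasurable u (volume.restrict s)) (hC : ∀ ρ ∈ s, |u ρ| ≤ C) :
    IntegrableOn (fun ρ ↦ g ρ (u ρ)) s := by
  refine Integrable.mono' ((hg.2.1.mono_set hs).mul_const C)
    (hg.1.comp_aemeasurable (aemeasurable_id.prodMk hu)).aestronglyMeasurable ?_
  filter_upwards [ae_restrict_of_ae_restrict_of_subset hs hg.ae_abs_sub_le,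
    ae_restrict_of_ae_restrict_of_subset hs hg.2.2, ae_restrict_mem hsm] with ρ h1 h2 h3
  have h4 := h1 (u ρ) 0
  rw [h2.1, sub_zero, sub_zero] at h4
  exact h4.trans (mul_le_mul_of_nonneg_left (hC ρ h3) h2.2.1)

/-- Discretization estimate: with a partition `0 = r₀ < r₁ < … < r_m = R` of mesh
`< δ` and `g_j(v) = ∫_{r_{j-1}}^{r_j} g(ρ,v) dρ`, the Preisach output is
approximated by the discrete one up to `δ ∫₀^R μ ≤ M δ`. -/
theorem stmt_12 (T R δ M : ℝ) (hT : 0 < T) (hδ : 0 < δ)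
    (g : ℝ → ℝ → ℝ) (μ : ℝ → ℝ) (hg : IsPreisachDensity g μ)
    (hM : M = ∫ ρ in Ioi (0:ℝ), μ ρ)
    (q q' : ℝ → ℝ) (hq : IsACOn T q q')
    (hqR : ∀ t ∈ Icc 0 T, |q t| < R)
    (ξ : ℝ → ℝ → ℝ) (hξ : ∀ ρ : ℝ, 0 < ρ → ∃ d, IsPlaySol T ρ q (ξ ρ) d)
    (m : ℕ) (r : ℕ → ℝ) (hr0 : r 0 = 0) (hrm : r m = R)
    (hrmono : ∀ j < m, r j < r (j + 1))
    (hrmesh : ∀ j < m, r (j + 1) - r j < δ) :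
    ∀ t ∈ Icc 0 T,
      |(∫ ρ in Ioi (0:ℝ), g ρ (ξ ρ t)) -
          ∑ j ∈ Finset.range m, ∫ ρ in (r j)..(r (j + 1)), g ρ (ξ (r (j + 1)) t)| ≤
        δ * (∫ ρ in (0:ℝ)..R, μ ρ) ∧
      δ * (∫ ρ in (0:ℝ)..R, μ ρ) ≤ M * δ := by
  intro t ht
  have hle : ∀ j ≤ m, 0 ≤ r j := by
    intro j
    induction j with
    | zero => exact fun _ ↦ hr0.ge
    | succ k ih => exact fun hk ↦ (ih (by omega)).trans (hrmono k (by omega)).le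
  have hR : 0 < R := (abs_nonneg _).trans_lt (hqR t ht)
  have hleR : ∀ j ≤ m, r j ≤ R := by
    intro j hj
    induction hj using Nat.decreasingInduction with
    | self => exact hrm.le
    | of_succ k hk ih => exact (hrmono k hk).le.trans ih
  have hlip : ∀ ρ σ, 0 < ρ → ρ ≤ σ → |ξ ρ t - ξ σ t| ≤ σ - ρ := by
    intro ρ σ hρ hρσ
    obtain ⟨d, hd⟩ := hξ ρ hρ
    obtain ⟨e, he⟩ := hξ σ (hρ.trans_le hρσ)
    exact hd.abs_sub_le hρσ hρ.le he t ht
  have hcont : ContinuousOn (fun ρ ↦ ξ ρ t) (Ioi 0) := by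
    refine LipschitzOnWith.continuousOn (K := 1) (LipschitzOnWith.of_dist_le_mul ?_)
    intro ρ hρ σ hσ
    rw [NNReal.coe_one, one_mul, Real.dist_eq, Real.dist_eq]
    rcases le_total ρ σ with h | h
    · rw [abs_sub_comm ρ σ]
      exact (hlip ρ σ hρ h).trans (le_abs_self _)
    · rw [abs_sub_comm (ξ ρ t)]
      exact (hlip σ ρ hσ h).trans (le_abs_self _)
  have hzero : ∀ ρ, R ≤ ρ → ξ ρ t = 0 := by
    intro ρ hρ
    obtain ⟨d, hd⟩ := hξ ρ (hR.trans_le hρ)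
    exact hd.eq_zero (fun τ hτ ↦ (hqR τ hτ).trans_le hρ) t ht
  have hbound : ∀ ρ ∈ Ioc 0 R, |ξ ρ t| ≤ R := by
    intro ρ hρ
    have h := hlip ρ R hρ.1 hρ.2
    rw [hzero R le_rfl, sub_zero] at h
    linarith [hρ.1]
  have hf : IntegrableOn (fun ρ ↦ g ρ (ξ ρ t)) (Ioc 0 R) :=
    hg.integrableOn_comp Ioc_subset_Ioi_self measurableSet_Ioc
      ((hcont.mono Ioc_subset_Ioi_self).aemeasurable measurableSet_Ioc) hbound
  have hIoi : ∫ ρ in Ioi (0 : ℝ), g ρ (ξ ρ t) = ∫ ρ in (0 : ℝ)..R, g ρ (ξ ρ t) := by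
    rw [intervalIntegral.integral_of_le hR.le]
    refine setIntegral_eq_of_subset_of_ae_sdiff_eq_zero measurableSet_Ioi.nullMeasurableSet
      Ioc_subset_Ioi_self ?_
    filter_upwards [(ae_restrict_iff' measurableSet_Ioi).1 hg.2.2] with ρ h1 hρ
    have hRρ : R ≤ ρ := by
      by_contra! hlt
      exact hρ.2 ⟨hρ.1, hlt.le⟩
    rw [hzero ρ hRρ]
    exact (h1 hρ.1).1
  have hsubset : ∀ j < m, Ioc (r j) (r (j + 1)) ⊆ Ioc 0 R := fun j hj ↦
    Ioc_subset_Ioc (hle j hj.le) (hleR (j + 1) hj)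
  have hfj : ∀ j < m, IntervalIntegrable (fun ρ ↦ g ρ (ξ ρ t)) volume (r j) (r (j + 1)) :=
    fun j hj ↦ (intervalIntegrable_iff_integrableOn_Ioc_of_le (hrmono j hj).le).2
      (hf.mono_set (hsubset j hj))
  have hgj : ∀ j < m,
      IntervalIntegrable (fun ρ ↦ g ρ (ξ (r (j + 1)) t)) volume (r j) (r (j + 1)) :=
    fun j hj ↦ (intervalIntegrable_iff_integrableOn_Ioc_of_le (hrmono j hj).le).2
      (hg.integrableOn_comp ((hsubset j hj).trans Ioc_subset_Ioi_self) measurableSet_Ioc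
        aemeasurable_const fun _ _ ↦ le_rfl)
  have hμj : ∀ j < m, IntervalIntegrable μ volume (r j) (r (j + 1)) :=
    fun j hj ↦ (intervalIntegrable_iff_integrableOn_Ioc_of_le (hrmono j hj).le).2
      (hg.2.1.mono_set ((hsubset j hj).trans Ioc_subset_Ioi_self))
  have hstep : ∀ j < m, |(∫ ρ in (r j)..(r (j + 1)), g ρ (ξ ρ t)) -
      ∫ ρ in (r j)..(r (j + 1)), g ρ (ξ (r (j + 1)) t)| ≤
        δ * ∫ ρ in (r j)..(r (j + 1)), μ ρ := by
    intro j hj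
    rw [← intervalIntegral.integral_sub (hfj j hj) (hgj j hj),
      ← intervalIntegral.integral_const_mul, ← Real.norm_eq_abs]
    refine intervalIntegral.norm_integral_le_of_norm_le (hrmono j hj).le ?_
      ((hμj j hj).const_mul δ)
    filter_upwards [(ae_restrict_iff' measurableSet_Ioi).1 hg.2.2,
      (ae_restrict_iff' measurableSet_Ioi).1 hg.ae_abs_sub_le] with ρ h1 h2 hρ
    have hpos : 0 < ρ := (hle j hj.le).trans_lt hρ.1
    rw [Real.norm_eq_abs, mul_comm δ]
    refine (h2 hpos _ _).trans (mul_le_mul_of_nonneg_left ?_ (h1 hpos).2.1)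
    linarith [hlip ρ _ hpos hρ.2, hrmesh j hj, hρ.1]
  have hsum : ∀ {f : ℝ → ℝ}, (∀ j < m, IntervalIntegrable f volume (r j) (r (j + 1))) →
      ∫ ρ in (0 : ℝ)..R, f ρ = ∑ j ∈ Finset.range m, ∫ ρ in (r j)..(r (j + 1)), f ρ := by
    intro f hf
    rw [intervalIntegral.sum_integral_adjacent_intervals hf, hr0, hrm]
  constructor
  · rw [hIoi, hsum hfj, hsum hμj, ← Finset.sum_sub_distrib, Finset.mul_sum]
    exact (Finset.abs_sum_le_sum_abs _ _).trans
      (Finset.sum_le_sum fun j hj ↦ hstep j (Finset.mem_range.1 hj))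
  · rw [mul_comm M, hM, intervalIntegral.integral_of_le hR.le]
    refine mul_le_mul_of_nonneg_left (setIntegral_mono_set hg.2.1 ?_
      Ioc_subset_Ioi_self.eventuallyLE) hδ.le
    filter_upwards [hg.2.2] with ρ hρ
    exact hρ.2.1
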